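/- Lemma 4.5, case 1 (type II highest elements): Let n ≥ 2, l ≥ k ≥ 1, let ι : B_l ⊗ B_k → B_k ⊗ B_l be any isomorphism of U_q'(C_n^(1)) crystals and H any energy function for ι. Let y_0 ≥ 1 and x_1, x_2 ≥ 0 be integers with x_1 + x_2 ≤ k and l − k ≥ 2y_0 − x_1, and set x̄_1 = k − x_1 − x_2. If l − k > y_0 ≥ x_1 − x̄_1, then, with z = min(y_0 + x̄_1 − x_1, l − k − y_0), one has ι((l−2y_0,0,---,0) ⊗ (x_1,x_2,---,x̄_1)) = (k,0,…,0) ⊗ (x_1+l−k−y_0−z, x_2, ---, x̄_1+y_0−z), and H((l−2y_0,0,---,0) ⊗ (x_1,x_2,---,x̄_1)) = 0. -/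

import Mathlib

namespace KTT

/-- Raw data of a crystal element `(x_1,…,x_n,x̄_n,…,x̄_1)`:
`b.1 i` is `x_{i+1}` and `b.2 i` is `x̄_{i+1}` for `i : Fin n`. -/
abbrev Tup (n : ℕ) := (Fin n → ℕ) × (Fin n → ℕ)

/-- The entry `x_j` (for `1 ≤ j ≤ n`). -/
def xc {n : ℕ} (b : Tup n) (j : ℕ) : ℕ :=
  if h : j - 1 < n then b.1 ⟨j - 1, h⟩ else 0

/-- The entry `x̄_j` (for `1 ≤ j ≤ n`). -/
def xbc {n : ℕ} (b : Tup n) (j : ℕ) : ℕ :=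
  if h : j - 1 < n then b.2 ⟨j - 1, h⟩ else 0

/-- Set the entry indexed by `j` (i.e. `x_j`) to the value `v`. -/
def setx {n : ℕ} (f : Fin n → ℕ) (j v : ℕ) : Fin n → ℕ :=
  fun t => if (t : ℕ) + 1 = j then v else f t

/-- `Σ_{i=1}^n (x_i + x̄_i)`. -/
def tsum {n : ℕ} (b : Tup n) : ℕ := ∑ i, (b.1 i + b.2 i)

/-- The element `(v,0,…,0)`. -/
def uvec (n v : ℕ) : Tup n := (fun j => if (j : ℕ) = 0 then v else 0, fun _ => 0)

/-- The element `(0,v,---,0)` (only `x_2 = v` nonzero). -/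
def u2vec (n v : ℕ) : Tup n := (fun j => if (j : ℕ) = 1 then v else 0, fun _ => 0)

/-- The element `(0,0,---,v)` (only `x̄_1 = v` nonzero). -/
def barvec (n v : ℕ) : Tup n := (fun _ => 0, fun j => if (j : ℕ) = 0 then v else 0)

/-- The element `(a,c,---,d)` with `x_1 = a`, `x_2 = c`, `x̄_1 = d`, all else `0`. -/
def tripleVec (n a c d : ℕ) : Tup n :=
  (fun j => if (j : ℕ) = 0 then a else if (j : ℕ) = 1 then c else 0,
   fun j => if (j : ℕ) = 0 then d else 0)

/-! ### The `U_q'(C_n^{(1)})` crystal `B_l` -/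

/-- Membership in the `C_n^{(1)}` crystal `B_l` : the sum of the entries belongs to
`{l, l-2, l-4, …}`. -/
def memC (n l : ℕ) (b : Tup n) : Prop := tsum b ≤ l ∧ (l - tsum b) % 2 = 0

def BC (n l : ℕ) : Set (Tup n) := {b | memC n l b}

/-- The number `x_0(b)` of `(0,0̄)` pairs. -/
def x0 (l : ℕ) {n : ℕ} (b : Tup n) : ℕ := (l - tsum b) / 2

/-- The operator `ẽ_i` on `B_l` (C case); `none` plays the role of `0`. -/
def eC (n l i : ℕ) (b : Tup n) : Option (Tup n) :=
  if i = 0 then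
    if 0 < n then
      if xbc b 1 + 2 ≤ xc b 1 then some (setx b.1 1 (xc b 1 - 2), b.2)
      else if xc b 1 = xbc b 1 + 1 then
        some (setx b.1 1 (xc b 1 - 1), setx b.2 1 (xbc b 1 + 1))
      else if tsum b + 2 ≤ l then some (b.1, setx b.2 1 (xbc b 1 + 2))
      else none
    else none
  else if i = n then
    if 0 < xbc b n then some (setx b.1 n (xc b n + 1), setx b.2 n (xbc b n - 1))
    else none
  else if i < n then
    if xbc b (i + 1) < xc b (i + 1) then
      some (setx (setx b.1 i (xc b i + 1)) (i + 1) (xc b (i + 1) - 1), b.2)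
    else if 0 < xbc b i then
      some (b.1, setx (setx b.2 (i + 1) (xbc b (i + 1) + 1)) i (xbc b i - 1))
    else none
  else none

/-- The operator `f̃_i` on `B_l` (C case). -/
def fC (n l i : ℕ) (b : Tup n) : Option (Tup n) :=
  if i = 0 then
    if 0 < n then
      if xbc b 1 ≤ xc b 1 then
        if tsum b + 2 ≤ l then some (setx b.1 1 (xc b 1 + 2), b.2) else none
      else if xc b 1 + 1 = xbc b 1 then
        some (setx b.1 1 (xc b 1 + 1), setx b.2 1 (xbc b 1 - 1))
      else some (b.1, setx b.2 1 (xbc b 1 - 2))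
    else none
  else if i = n then
    if 0 < xc b n then some (setx b.1 n (xc b n - 1), setx b.2 n (xbc b n + 1))
    else none
  else if i < n then
    if xbc b (i + 1) ≤ xc b (i + 1) then
      if 0 < xc b i then
        some (setx (setx b.1 i (xc b i - 1)) (i + 1) (xc b (i + 1) + 1), b.2)
      else none
    else some (b.1, setx (setx b.2 (i + 1) (xbc b (i + 1) - 1)) i (xbc b i + 1))
  else none

def eCIter (n l i m : ℕ) (b : Tup n) : Option (Tup n) :=
  (fun o => Option.bind o (eC n l i))^[m] (some b)

def fCIter (n l i m : ℕ) (b : Tup n) : Option (Tup n) :=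
  (fun o => Option.bind o (fC n l i))^[m] (some b)

/-- `ε_i(b) = max {m | ẽ_i^m b ≠ 0}` (C case). -/
noncomputable def epsC (n l i : ℕ) (b : Tup n) : ℕ :=
  sSup {m | eCIter n l i m b ≠ none}

/-- `φ_i(b) = max {m | f̃_i^m b ≠ 0}` (C case). -/
noncomputable def phiC (n l i : ℕ) (b : Tup n) : ℕ :=
  sSup {m | fCIter n l i m b ≠ none}

/-- `ẽ_i` on the tensor product `B_l ⊗ B_k` (C case). -/
noncomputable def eTenC (n l k i : ℕ) (u : Tup n × Tup n) : Option (Tup n × Tup n) :=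
  if epsC n k i u.2 ≤ phiC n l i u.1 then (eC n l i u.1).map (fun c => (c, u.2))
  else (eC n k i u.2).map (fun c => (u.1, c))

/-- `f̃_i` on the tensor product `B_l ⊗ B_k` (C case). -/
noncomputable def fTenC (n l k i : ℕ) (u : Tup n × Tup n) : Option (Tup n × Tup n) :=
  if epsC n k i u.2 < phiC n l i u.1 then (fC n l i u.1).map (fun c => (c, u.2))
  else (fC n k i u.2).map (fun c => (u.1, c))

/-- `ι : B_l ⊗ B_k → B_k ⊗ B_l` is an isomorphism of `U_q'(C_n^{(1)})` crystals. -/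
def IsIsoC (n l k : ℕ) (ι : Tup n × Tup n → Tup n × Tup n) : Prop :=
  Set.BijOn ι (BC n l ×ˢ BC n k) (BC n k ×ˢ BC n l) ∧
  ∀ u ∈ BC n l ×ˢ BC n k, ∀ i ≤ n,
    Option.map ι (eTenC n l k i u) = eTenC n k l i (ι u) ∧
    Option.map ι (fTenC n l k i u) = fTenC n k l i (ι u)

/-- `H` is an energy function for the isomorphism `ι` (C case), normalized by
`H((l,0,…,0) ⊗ (0,k,---,0)) = 0`. -/
def IsEnergyC (n l k : ℕ) (ι : Tup n × Tup n → Tup n × Tup n)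
    (H : Tup n × Tup n → ℤ) : Prop :=
  (∀ u ∈ BC n l ×ˢ BC n k, ∀ i ≤ n, ∀ v, eTenC n l k i u = some v →
      H v = H u +
        (if i = 0 then
          (if epsC n k 0 u.2 ≤ phiC n l 0 u.1 ∧ epsC n l 0 (ι u).2 ≤ phiC n k 0 (ι u).1
           then 1
           else if phiC n l 0 u.1 < epsC n k 0 u.2 ∧ phiC n k 0 (ι u).1 < epsC n l 0 (ι u).2
           then -1 else 0)
         else 0)) ∧
  H (uvec n l, u2vec n k) = 0

/-! ### The `U_q'(A_{2n-1}^{(2)})` crystal `B_l` -/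

def memA (n l : ℕ) (b : Tup n) : Prop := tsum b = l

def BA (n l : ℕ) : Set (Tup n) := {b | memA n l b}

/-- The operator `ẽ_i` (A case). -/
def eA (n i : ℕ) (b : Tup n) : Option (Tup n) :=
  if i = 0 then
    if 1 < n then
      if xbc b 2 < xc b 2 then some (setx b.1 2 (xc b 2 - 1), setx b.2 1 (xbc b 1 + 1))
      else if 0 < xc b 1 then some (setx b.1 1 (xc b 1 - 1), setx b.2 2 (xbc b 2 + 1))
      else none
    else none
  else if i = n then
    if 0 < xbc b n then some (setx b.1 n (xc b n + 1), setx b.2 n (xbc b n - 1))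
    else none
  else if i < n then
    if xbc b (i + 1) < xc b (i + 1) then
      some (setx (setx b.1 i (xc b i + 1)) (i + 1) (xc b (i + 1) - 1), b.2)
    else if 0 < xbc b i then
      some (b.1, setx (setx b.2 (i + 1) (xbc b (i + 1) + 1)) i (xbc b i - 1))
    else none
  else none

/-- The operator `f̃_i` (A case). -/
def fA (n i : ℕ) (b : Tup n) : Option (Tup n) :=
  if i = 0 then
    if 1 < n then
      if xbc b 2 ≤ xc b 2 then
        if 0 < xbc b 1 then some (setx b.1 2 (xc b 2 + 1), setx b.2 1 (xbc b 1 - 1))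
        else none
      else some (setx b.1 1 (xc b 1 + 1), setx b.2 2 (xbc b 2 - 1))
    else none
  else if i = n then
    if 0 < xc b n then some (setx b.1 n (xc b n - 1), setx b.2 n (xbc b n + 1))
    else none
  else if i < n then
    if xbc b (i + 1) ≤ xc b (i + 1) then
      if 0 < xc b i then
        some (setx (setx b.1 i (xc b i - 1)) (i + 1) (xc b (i + 1) + 1), b.2)
      else none
    else some (b.1, setx (setx b.2 (i + 1) (xbc b (i + 1) - 1)) i (xbc b i + 1))
  else none

def eAIter (n i m : ℕ) (b : Tup n) : Option (Tup n) :=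
  (fun o => Option.bind o (eA n i))^[m] (some b)

def fAIter (n i m : ℕ) (b : Tup n) : Option (Tup n) :=
  (fun o => Option.bind o (fA n i))^[m] (some b)

noncomputable def epsA (n i : ℕ) (b : Tup n) : ℕ :=
  sSup {m | eAIter n i m b ≠ none}

noncomputable def phiA (n i : ℕ) (b : Tup n) : ℕ :=
  sSup {m | fAIter n i m b ≠ none}

/-- `ẽ_i` on a tensor product (A case). -/
noncomputable def eTenA (n i : ℕ) (u : Tup n × Tup n) : Option (Tup n × Tup n) :=
  if epsA n i u.2 ≤ phiA n i u.1 then (eA n i u.1).map (fun c => (c, u.2))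
  else (eA n i u.2).map (fun c => (u.1, c))

/-- `f̃_i` on a tensor product (A case). -/
noncomputable def fTenA (n i : ℕ) (u : Tup n × Tup n) : Option (Tup n × Tup n) :=
  if epsA n i u.2 < phiA n i u.1 then (fA n i u.1).map (fun c => (c, u.2))
  else (fA n i u.2).map (fun c => (u.1, c))

/-- `ι : B_l ⊗ B_k → B_k ⊗ B_l` is an isomorphism of `U_q'(A_{2n-1}^{(2)})` crystals. -/
def IsIsoA (n l k : ℕ) (ι : Tup n × Tup n → Tup n × Tup n) : Prop :=
  Set.BijOn ι (BA n l ×ˢ BA n k) (BA n k ×ˢ BA n l) ∧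
  ∀ u ∈ BA n l ×ˢ BA n k, ∀ i ≤ n,
    Option.map ι (eTenA n i u) = eTenA n i (ι u) ∧
    Option.map ι (fTenA n i u) = fTenA n i (ι u)

/-- `H` is an energy function for `ι` (A case), normalized by
`H((l,0,…,0) ⊗ (0,0,---,k)) = 0`. -/
def IsEnergyA (n l k : ℕ) (ι : Tup n × Tup n → Tup n × Tup n)
    (H : Tup n × Tup n → ℤ) : Prop :=
  (∀ u ∈ BA n l ×ˢ BA n k, ∀ i ≤ n, ∀ v, eTenA n i u = some v →
      H v = H u +
        (if i = 0 then
          (if epsA n 0 u.2 ≤ phiA n 0 u.1 ∧ epsA n 0 (ι u).2 ≤ phiA n 0 (ι u).1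
           then 1
           else if phiA n 0 u.1 < epsA n 0 u.2 ∧ phiA n 0 (ι u).1 < epsA n 0 (ι u).2
           then -1 else 0)
         else 0)) ∧
  H (uvec n l, barvec n k) = 0

/-! ### Words, tableaux and column insertion

Letters are encoded as natural numbers: the unbarred letter `j` (for `0 ≤ j ≤ n`) is `j`,
and the barred letter `j̄` is `2n+1-j`; the natural order of `ℕ` is the order
`0 < 1 < ⋯ < n < n̄ < ⋯ < 1̄ < 0̄`.  A (two-row) tableau is encoded as the list of its
columns (left to right), each column being the list of its entries (top to bottom). -/

/-- The barred partner `j̄` of an unbarred letter `j`. -/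
def bar (n j : ℕ) : ℕ := 2 * n + 1 - j

/-- Column insertion of a letter into a tableau with at most two rows. -/
def insertLetter (n : ℕ) : ℕ → List (List ℕ) → List (List ℕ)
  | a, [] => [[a]]
  | a, [p] :: rest =>
      if a ≤ p then [a] :: insertLetter n p rest else [p, a] :: rest
  | a, [p, q] :: rest =>
      if p ≠ 0 ∧ p ≤ n ∧ q = bar n p ∧ p ≤ a ∧ a ≤ q then
        -- the column is a pair `(x, x̄)` with `x ≠ 0` and `x ≤ a ≤ x̄`
        [p - 1, a] :: insertLetter n (bar n (p - 1)) rest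
      else if n + 1 ≤ q ∧ bar n q < p ∧ p < q ∧ a = bar n q ∧ q ≠ n + 1 then
        -- the column is `(β, x̄)` with `x < β < x̄`, `a = x` and `x ≠ n`
        [a + 1, bar n (a + 1)] :: insertLetter n p rest
      else if a ≤ p then [a, q] :: insertLetter n p rest
      else if a ≤ q then [p, a] :: insertLetter n q rest
      else [p, q, a] :: rest
  | a, C :: rest => (C ++ [a]) :: rest

/-- Column insertion of a word `u = u_1 ⋯ u_j` into a tableau: `u_j` first, `u_1` last. -/
def insertWord (n : ℕ) (u : List ℕ) (T : List (List ℕ)) : List (List ℕ) :=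
  u.foldr (fun a T => insertLetter n a T) T

/-- One step of reverse insertion: letter `g` comes back (moving leftward) into a column;
returns the restored column together with the letter passed further left. -/
def revStep (n g : ℕ) (C : List ℕ) : List ℕ × ℕ :=
  match C with
  | [p] => ([g], p)
  | [p, q] =>
      if p ≠ 0 ∧ p ≤ n ∧ q = bar n p ∧ p ≤ g ∧ g ≤ q then
        ([g, bar n (p - 1)], p - 1)
      else if p ≤ n ∧ g = bar n p ∧ p < q ∧ q < g ∧ p ≠ n then
        ([p + 1, bar n (p + 1)], q)
      else if q ≤ g then ([p, g], q)
      else ([g, q], p)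
  | _ => (C, g)

/-- Reverse insertion of a letter through a list of columns, from right to left;
returns the new columns and the letter ejected from the leftmost column. -/
def revPass (n g : ℕ) : List (List ℕ) → List (List ℕ) × ℕ
  | [] => ([], g)
  | C :: rest =>
      let p := revPass n g rest
      let q := revStep n p.2 C
      (q.1 :: p.1, q.2)

/-- Reverse-bump the rightmost cell of the first row (the last column, a single box). -/
def rbFirst (n : ℕ) (T : List (List ℕ)) : List (List ℕ) × ℕ :=
  match T.getLast? with
  | some [a] => revPass n a T.dropLast
  | _ => (T, 0)

/-- Number of columns of height (at least) two, i.e. the length of the second row. -/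
def numTwoCols (T : List (List ℕ)) : ℕ :=
  (T.filter (fun C => decide (2 ≤ C.length))).length

/-- Reverse-bump the rightmost cell of the second row. -/
def rbSecond (n : ℕ) (T : List (List ℕ)) : List (List ℕ) × ℕ :=
  match (T.drop (numTwoCols T - 1)).head? with
  | some [a, b] =>
      let p := revPass n b (T.take (numTwoCols T - 1))
      (p.1 ++ [a] :: T.drop (numTwoCols T), p.2)
  | _ => (T, 0)

/-- Iterate a reverse-bumping step, collecting the ejected letters in order of ejection. -/
def rbIter (step : List (List ℕ) → List (List ℕ) × ℕ) :
    ℕ → List (List ℕ) → List (List ℕ) × List ℕ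
  | 0, T => (T, [])
  | c + 1, T =>
      let p := step T
      let q := rbIter step c p.1
      (q.1, p.2 :: q.2)

/-- A one-row word regarded as a tableau (list of one-box columns). -/
def rowCols (w : List ℕ) : List (List ℕ) := w.map (fun a => [a])

/-- The row word of a one-row tableau. -/
def colsWord (T : List (List ℕ)) : List ℕ := T.foldr (fun C acc => C ++ acc) []

/-- The word `1^{x_1} ⋯ n^{x_n} n̄^{x̄_n} ⋯ 1̄^{x̄_1}`. -/
def coreWord (n : ℕ) (b : Tup n) : List ℕ :=
  ((List.finRange n).map (fun i => List.replicate (b.1 i) ((i : ℕ) + 1))).foldr (· ++ ·) []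
  ++ ((List.finRange n).reverse.map
      (fun i => List.replicate (b.2 i) (bar n ((i : ℕ) + 1)))).foldr (· ++ ·) []

/-- The word `𝕋(b) = 0^{x_0} 1^{x_1} ⋯ 1̄^{x̄_1} 0̄^{x_0}` of an element of the
`C_n^{(1)}` crystal `B_l`. -/
def rowWordC (n l : ℕ) (b : Tup n) : List ℕ :=
  List.replicate (x0 l b) 0 ++ coreWord n b ++ List.replicate (x0 l b) (bar n 0)

/-- The word `𝕋(b)` with `z` pairs `(0, 0̄)` removed. -/
def hatWordC (n l z : ℕ) (b : Tup n) : List ℕ :=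
  List.replicate (x0 l b - z) 0 ++ coreWord n b ++ List.replicate (x0 l b - z) (bar n 0)

/-- The word `𝒯(b) = 1^{x_1} ⋯ 1̄^{x̄_1}` of an element of the `A_{2n-1}^{(2)}` crystal. -/
def rowWordA (n : ℕ) (b : Tup n) : List ℕ := coreWord n b


theorem sup_eq {α : Type*} (F : α → Option α) (P : α → Prop) (g : α → ℕ)
    (h1 : ∀ b b', P b → F b = some b' → P b' ∧ g b = g b' + 1)
    (h2 : ∀ b, P b → F b = none → g b = 0) (b : α) (hb : P b) :
    sSup {m | (fun o => Option.bind o F)^[m] (some b) ≠ none} = g b := by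
  have hnone : ∀ m, (fun o => Option.bind o F)^[m] none = none := by
    intro m
    induction m with
    | zero => rfl
    | succ m ih => simpa [Function.iterate_succ] using ih
  have key : ∀ m b, P b → ((fun o => Option.bind o F)^[m] (some b) ≠ none ↔ m ≤ g b) := by
    intro m
    induction m with
    | zero => intro b _; simp
    | succ m ih =>
      intro b hb
      rw [Function.iterate_succ_apply]
      rcases hF : F b with _ | b'
      · have := h2 b hb hF
        simp [hF, hnone, this]
      · have := h1 b b' hb hF
        simp only [Option.bind_some, hF]
        rw [ih b' this.1]
        omega
  have : {m | (fun o => Option.bind o F)^[m] (some b) ≠ none} = Set.Iic (g b) := by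
    ext m; simpa using key m b hb
  rw [this, csSup_Iic]

section basics
variable {n : ℕ}

theorem xc_setx (f g : Fin n → ℕ) (i j v : ℕ) (h1 : 1 ≤ j) (h2 : j ≤ n) :
    xc ((setx f i v, g) : Tup n) j = if j = i then v else xc ((f, g) : Tup n) j := by
  have : j - 1 < n := by omega
  have h3 : j - 1 + 1 = j := by omega
  simp [xc, setx, this, h3]

theorem xbc_setx (f g : Fin n → ℕ) (i j v : ℕ) (h1 : 1 ≤ j) (h2 : j ≤ n) :
    xbc ((g, setx f i v) : Tup n) j = if j = i then v else xbc ((g, f) : Tup n) j := by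
  have : j - 1 < n := by omega
  have h3 : j - 1 + 1 = j := by omega
  simp [xbc, setx, this, h3]

theorem xc_fst (b : Tup n) (g : Fin n → ℕ) (j : ℕ) : xc ((b.1, g) : Tup n) j = xc b j := rfl
theorem xbc_snd (b : Tup n) (g : Fin n → ℕ) (j : ℕ) : xbc ((g, b.2) : Tup n) j = xbc b j := rfl

theorem tup_ext (b b' : Tup n)
    (h : ∀ i, 1 ≤ i → i ≤ n → xc b i = xc b' i ∧ xbc b i = xbc b' i) : b = b' := by
  apply Prod.ext
  · funext t
    have := (h (t + 1) (by omega) (by omega)).1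
    simpa [xc] using this
  · funext t
    have := (h (t + 1) (by omega) (by omega)).2
    simpa [xbc] using this

theorem sum_setx (f : Fin n → ℕ) (j v : ℕ) (h1 : 1 ≤ j) (h2 : j ≤ n) :
    ∑ t, setx f j v t + f ⟨j - 1, by omega⟩ = ∑ t, f t + v := by
  have e : setx f j v = Function.update f ⟨j - 1, by omega⟩ v := by
    funext t
    simp only [setx, Function.update_apply, Fin.ext_iff]
    have : ((t : ℕ) + 1 = j) ↔ ((t : ℕ) = j - 1) := by omega
    simp [this]
  rw [e, Finset.sum_update_of_mem (Finset.mem_univ _),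
    ← Finset.sum_sdiff (Finset.subset_univ {(⟨j - 1, by omega⟩ : Fin n)})]
  simp; omega

theorem tsum_mk (f g : Fin n → ℕ) : tsum ((f, g) : Tup n) = ∑ t, f t + ∑ t, g t := by
  simp [tsum, Finset.sum_add_distrib]

theorem tsum_setx1 (f g : Fin n → ℕ) (j v : ℕ) (h1 : 1 ≤ j) (h2 : j ≤ n) :
    tsum ((setx f j v, g) : Tup n) + xc ((f, g) : Tup n) j = tsum ((f, g) : Tup n) + v := by
  have := sum_setx f j v h1 h2
  have h : j - 1 < n := by omega
  simp only [tsum_mk, xc, h, dite_true]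
  omega

theorem tsum_setx2 (f g : Fin n → ℕ) (j v : ℕ) (h1 : 1 ≤ j) (h2 : j ≤ n) :
    tsum ((g, setx f j v) : Tup n) + xbc ((g, f) : Tup n) j = tsum ((g, f) : Tup n) + v := by
  have := sum_setx f j v h1 h2
  have h : j - 1 < n := by omega
  simp only [tsum_mk, xbc, h, dite_true]
  omega

theorem x1_le (hn : 2 ≤ n) (b : Tup n) : xc b 1 + xbc b 1 ≤ tsum b := by
  obtain ⟨f, g⟩ := b
  rw [tsum_mk]
  have h : 1 - 1 < n := by omega
  simp only [xc, xbc, h, dite_true]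
  exact add_le_add (Finset.single_le_sum (f := f) (by simp) (Finset.mem_univ _))
    (Finset.single_le_sum (f := g) (by simp) (Finset.mem_univ _))

def g0 (l : ℕ) (b : Tup n) : ℕ := (l - tsum b) / 2 + (xc b 1 - xbc b 1)
def p0 (l : ℕ) (b : Tup n) : ℕ := (l - tsum b) / 2 + (xbc b 1 - xc b 1)

theorem e0_step (hn : 2 ≤ n) (l : ℕ) (b b' : Tup n) (hb : tsum b ≤ l)
    (h : eC n l 0 b = some b') : tsum b' ≤ l ∧ g0 l b = g0 l b' + 1 := by
  have hx := x1_le hn b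
  have hn1 : 1 ≤ n := by omega
  obtain ⟨f, g⟩ := b
  unfold eC at h
  have h0 : 0 < n := by omega
  simp only [if_true, h0] at h
  unfold g0
  split_ifs at h with c1 c2 c3
  · simp only [Option.some.injEq] at h
    subst h
    have t1 := tsum_setx1 f g 1 (xc ((f, g) : Tup n) 1 - 2) le_rfl hn1
    rw [xc_setx _ _ _ _ _ le_rfl hn1, if_pos rfl]
    have : xbc ((setx f 1 (xc ((f, g) : Tup n) 1 - 2), g) : Tup n) 1 = xbc ((f, g) : Tup n) 1 := rfl
    rw [this]
    omega
  · simp only [Option.some.injEq] at h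
    subst h
    have t1 := tsum_setx1 f g 1 (xc ((f, g) : Tup n) 1 - 1) le_rfl hn1
    have t2 := tsum_setx2 g (setx f 1 (xc ((f, g) : Tup n) 1 - 1)) 1 (xbc ((f, g) : Tup n) 1 + 1)
      le_rfl hn1
    rw [xc_setx _ _ _ _ _ le_rfl hn1, if_pos rfl, xbc_setx _ _ _ _ _ le_rfl hn1, if_pos rfl]
    have : xbc ((setx f 1 (xc ((f, g) : Tup n) 1 - 1), g) : Tup n) 1 = xbc ((f, g) : Tup n) 1 := rfl
    rw [this] at t2
    omega
  · simp only [Option.some.injEq] at h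
    subst h
    have t1 := tsum_setx2 g f 1 (xbc ((f, g) : Tup n) 1 + 2) le_rfl hn1
    rw [xbc_setx _ _ _ _ _ le_rfl hn1, if_pos rfl]
    have : xc ((f, setx g 1 (xbc ((f, g) : Tup n) 1 + 2)) : Tup n) 1 = xc ((f, g) : Tup n) 1 := rfl
    rw [this]
    omega

theorem f0_step (hn : 2 ≤ n) (l : ℕ) (b b' : Tup n) (hb : tsum b ≤ l)
    (h : fC n l 0 b = some b') : tsum b' ≤ l ∧ p0 l b = p0 l b' + 1 := by
  have hx := x1_le hn b
  have hn1 : 1 ≤ n := by omega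
  obtain ⟨f, g⟩ := b
  unfold fC at h
  have h0 : 0 < n := by omega
  simp only [if_true, h0] at h
  unfold p0
  split_ifs at h with c1 c2 c3
  · simp only [Option.some.injEq] at h
    subst h
    have t1 := tsum_setx1 f g 1 (xc ((f, g) : Tup n) 1 + 2) le_rfl hn1
    rw [xc_setx _ _ _ _ _ le_rfl hn1, if_pos rfl]
    have : xbc ((setx f 1 (xc ((f, g) : Tup n) 1 + 2), g) : Tup n) 1 = xbc ((f, g) : Tup n) 1 := rfl
    rw [this]
    omega
  · simp only [Option.some.injEq] at h
    subst h
    have t1 := tsum_setx1 f g 1 (xc ((f, g) : Tup n) 1 + 1) le_rfl hn1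
    have t2 := tsum_setx2 g (setx f 1 (xc ((f, g) : Tup n) 1 + 1)) 1 (xbc ((f, g) : Tup n) 1 - 1)
      le_rfl hn1
    rw [xc_setx _ _ _ _ _ le_rfl hn1, if_pos rfl, xbc_setx _ _ _ _ _ le_rfl hn1, if_pos rfl]
    have : xbc ((setx f 1 (xc ((f, g) : Tup n) 1 + 1), g) : Tup n) 1 = xbc ((f, g) : Tup n) 1 := rfl
    rw [this] at t2
    omega
  · simp only [Option.some.injEq] at h
    subst h
    have t1 := tsum_setx2 g f 1 (xbc ((f, g) : Tup n) 1 - 2) le_rfl hn1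
    rw [xbc_setx _ _ _ _ _ le_rfl hn1, if_pos rfl]
    have : xc ((f, setx g 1 (xbc ((f, g) : Tup n) 1 - 2)) : Tup n) 1 = xc ((f, g) : Tup n) 1 := rfl
    rw [this]
    omega

theorem eps0_eq (hn : 2 ≤ n) (l : ℕ) (b : Tup n) (hb : tsum b ≤ l) :
    epsC n l 0 b = g0 l b := by
  refine sup_eq (eC n l 0) (fun b => tsum b ≤ l) (g0 l) (fun b b' => e0_step hn l b b') ?_ b hb
  intro b hb h
  have h0 : 0 < n := by omega
  simp only [eC, if_true, h0] at h
  unfold g0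
  split_ifs at h
  omega

theorem phi0_eq (hn : 2 ≤ n) (l : ℕ) (b : Tup n) (hb : tsum b ≤ l) :
    phiC n l 0 b = p0 l b := by
  refine sup_eq (fC n l 0) (fun b => tsum b ≤ l) (p0 l) (fun b b' => f0_step hn l b b') ?_ b hb
  intro b hb h
  have h0 : 0 < n := by omega
  simp only [fC, if_true, h0] at h
  unfold p0
  split_ifs at h
  omega

def gi (n i : ℕ) (b : Tup n) : ℕ :=
  if i = n then xbc b n else xbc b i + (xc b (i + 1) - xbc b (i + 1))
def pi' (n i : ℕ) (b : Tup n) : ℕ :=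
  if i = n then xc b n else xc b i + (xbc b (i + 1) - xc b (i + 1))

theorem eps_eq (l i : ℕ) (h1 : 1 ≤ i) (h2 : i ≤ n) (b : Tup n) :
    epsC n l i b = gi n i b := by
  refine sup_eq (eC n l i) (fun b => True) (gi n i) ?_ ?_ b trivial
  · intro b b' _ h
    refine ⟨trivial, ?_⟩
    have h0 : i ≠ 0 := by omega
    simp only [eC, h0, if_false] at h
    unfold gi
    split_ifs at h ⊢ with c1 c2 c3 c4 <;> (try (simp only [Option.some.injEq] at h; subst h))
    · rw [xbc_setx _ _ _ _ _ (by omega) (by omega), if_pos rfl]; omega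
    · rw [xc_setx _ _ _ _ _ (by omega) (by omega), if_pos rfl]
      simp only [xbc_snd]; omega
    · rw [xbc_setx _ _ _ _ _ (by omega) (by omega), if_pos rfl,
        xbc_setx _ _ _ _ _ (by omega) (by omega), if_neg (by omega),
        xbc_setx _ _ _ _ _ (by omega) (by omega), if_pos rfl]
      simp only [xc_fst]; omega
  · intro b _ h
    have h0 : i ≠ 0 := by omega
    simp only [eC, h0, if_false] at h
    unfold gi
    split_ifs at h ⊢ <;> omega

theorem phi_eq (l i : ℕ) (h1 : 1 ≤ i) (h2 : i ≤ n) (b : Tup n) :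
    phiC n l i b = pi' n i b := by
  refine sup_eq (fC n l i) (fun b => True) (pi' n i) ?_ ?_ b trivial
  · intro b b' _ h
    refine ⟨trivial, ?_⟩
    have h0 : i ≠ 0 := by omega
    simp only [fC, h0, if_false] at h
    unfold pi'
    split_ifs at h ⊢ with c1 c2 c3 c4 <;> (try (simp only [Option.some.injEq] at h; subst h))
    · rw [xc_setx _ _ _ _ _ (by omega) (by omega), if_pos rfl]; omega
    · rw [xc_setx _ _ _ _ _ (by omega) (by omega), if_neg (by omega),
        xc_setx _ _ _ _ _ (by omega) (by omega), if_pos rfl,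
        xc_setx _ _ _ _ _ (by omega) (by omega), if_pos rfl]
      simp only [xbc_snd]; omega
    · rw [xbc_setx _ _ _ _ _ (by omega) (by omega), if_neg (by omega),
        xbc_setx _ _ _ _ _ (by omega) (by omega), if_pos rfl]
      simp only [xc_fst]; omega
  · intro b _ h
    have h0 : i ≠ 0 := by omega
    simp only [fC, h0, if_false] at h
    unfold pi'
    split_ifs at h ⊢ <;> omega

/-- state: `x_1 = p`, `x̄_1 = q`, plus one unit at letter `j ∈ {1..2n}`. -/
def S (n p q j : ℕ) : Tup n :=
  (fun t => (if (t : ℕ) = 0 then p else 0) + (if (t : ℕ) + 1 = j then 1 else 0),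
   fun t => (if (t : ℕ) = 0 then q else 0) + (if (t : ℕ) + j = 2 * n then 1 else 0))

theorem xc_S (p q j i : ℕ) (h1 : 1 ≤ i) (h2 : i ≤ n) :
    xc (S n p q j) i = (if i = 1 then p else 0) + (if i = j then 1 else 0) := by
  have h : i - 1 < n := by omega
  simp only [xc, S, h, dite_true]
  split_ifs <;> omega

theorem xbc_S (p q j i : ℕ) (h1 : 1 ≤ i) (h2 : i ≤ n) :
    xbc (S n p q j) i = (if i = 1 then q else 0) + (if i + j = 2 * n + 1 then 1 else 0) := by
  have h : i - 1 < n := by omega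
  simp only [xbc, S, h, dite_true]
  split_ifs <;> omega

theorem xc_T (a c d i : ℕ) (h1 : 1 ≤ i) (h2 : i ≤ n) :
    xc (tripleVec n a c d) i = if i = 1 then a else if i = 2 then c else 0 := by
  have h : i - 1 < n := by omega
  simp only [xc, tripleVec, h, dite_true]
  split_ifs <;> omega

theorem xbc_T (a c d i : ℕ) (h1 : 1 ≤ i) (h2 : i ≤ n) :
    xbc (tripleVec n a c d) i = if i = 1 then d else 0 := by
  have h : i - 1 < n := by omega
  simp only [xbc, tripleVec, h, dite_true]
  split_ifs <;> omega

theorem tsum_zero : tsum ((fun _ => 0, fun _ => 0) : Tup n) = 0 := by simp [tsum]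

theorem tsum_T (hn : 2 ≤ n) (a c d : ℕ) : tsum (tripleVec n a c d) = a + c + d := by
  have e : tripleVec n a c d = (setx (setx (fun _ => 0) 2 c) 1 a, setx (fun _ => 0) 1 d) := by
    apply tup_ext
    intro i h1 h2
    rw [xc_T _ _ _ _ h1 h2, xbc_T _ _ _ _ h1 h2, xc_setx _ _ _ _ _ h1 h2,
      xc_setx _ _ _ _ _ h1 h2, xbc_setx _ _ _ _ _ h1 h2]
    simp [xc, xbc]
  have s1 := sum_setx (n := n) (fun _ => 0) 2 c (by omega) (by omega)
  have s2 := sum_setx (n := n) (setx (fun _ => 0) 2 c) 1 a (by omega) (by omega)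
  have s3 := sum_setx (n := n) (fun _ => 0) 1 d (by omega) (by omega)
  rw [e, tsum_mk]
  simp [setx] at s1 s2 s3 ⊢
  omega

theorem tsum_S (hn : 2 ≤ n) (p q j : ℕ) (h1 : 1 ≤ j) (h2 : j ≤ 2 * n) :
    tsum (S n p q j) = p + q + 1 := by
  have a1 : ∀ r : ℕ, ∑ t : Fin n, (if (t : ℕ) = 0 then r else 0) = r := by
    intro r
    have := sum_setx (n := n) (fun _ => 0) 1 r (by omega) (by omega)
    simpa [setx] using this
  have a2 : ∑ t : Fin n, (if (t : ℕ) + 1 = j then 1 else 0)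
      + ∑ t : Fin n, (if (t : ℕ) + j = 2 * n then 1 else 0) = 1 := by
    by_cases hj : j ≤ n
    · have := sum_setx (n := n) (fun _ => 0) j 1 (by omega) (by omega)
      have z : ∑ t : Fin n, (if (t : ℕ) + j = 2 * n then 1 else 0) = 0 := by
        apply Finset.sum_eq_zero
        intro t _
        rw [if_neg]; omega
      simp only [setx] at this
      rw [z]
      simpa using this
    · have := sum_setx (n := n) (fun _ => 0) (2 * n + 1 - j) 1 (by omega) (by omega)
      have z : ∑ t : Fin n, (if (t : ℕ) + 1 = j then 1 else 0) = 0 := by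
        apply Finset.sum_eq_zero
        intro t _
        rw [if_neg]; omega
      have w : ∀ t : Fin n, ((t : ℕ) + j = 2 * n) ↔ ((t : ℕ) + 1 = 2 * n + 1 - j) := by
        intro t; omega
      simp only [setx] at this
      simp only [z, w]
      simpa using this
  unfold S
  rw [tsum_mk, Finset.sum_add_distrib, Finset.sum_add_distrib, a1, a1]
  omega

/-- the node used to move letter `j` to `j+1` -/
def nd (n j : ℕ) : ℕ := if j ≤ n then j else 2 * n - j

theorem fS (hn : 2 ≤ n) (l p q j : ℕ) (h1 : 1 ≤ j) (h2 : j < 2 * n) :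
    fC n l (nd n j) (S n p q j) = some (S n p q (j + 1)) := by
  have hi : 1 ≤ nd n j ∧ nd n j ≤ n ∧ (nd n j = j ∨ (n < j ∧ nd n j = 2 * n - j)) := by
    unfold nd; split_ifs <;> omega
  generalize nd n j = i at hi ⊢
  obtain ⟨i1, i2, i3⟩ := hi
  have h0 : i ≠ 0 := by omega
  simp only [fC, h0, if_false]
  by_cases hin : i = n
  · subst hin
    have hj : j = i := by omega
    subst hj
    simp only [xc_S _ _ _ _ h1 le_rfl, xbc_S _ _ _ _ h1 le_rfl, if_true]
    rw [if_pos (by omega)]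
    congr 1
    apply tup_ext
    intro t t1 t2
    rw [xc_setx _ _ _ _ _ t1 t2, xbc_setx _ _ _ _ _ t1 t2, xc_fst, xbc_snd]
    simp only [xc_S _ _ _ _ t1 t2, xbc_S _ _ _ _ t1 t2]
    constructor <;> split_ifs <;> omega
  · have hin' : i < n := by omega
    simp only [hin, hin', if_true, if_false, xc_S _ _ _ _ i1 i2, xbc_S _ _ _ _ i1 i2,
      xc_S _ _ _ (i + 1) (by omega) hin', xbc_S _ _ _ (i + 1) (by omega) hin']
    rcases i3 with hj | ⟨hj, hj'⟩
    · subst hj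
      rw [if_pos (by split_ifs <;> omega), if_pos (by split_ifs <;> omega)]
      congr 1
      apply tup_ext
      intro t t1 t2
      rw [xc_setx _ _ _ _ _ t1 t2, xc_setx _ _ _ _ _ t1 t2, xc_fst, xbc_snd]
      simp only [xc_S _ _ _ _ t1 t2, xbc_S _ _ _ _ t1 t2]
      constructor <;> split_ifs <;> omega
    · rw [if_neg (by split_ifs <;> omega)]
      congr 1
      apply tup_ext
      intro t t1 t2
      rw [xbc_setx _ _ _ _ _ t1 t2, xbc_setx _ _ _ _ _ t1 t2, xc_fst, xbc_snd]
      simp only [xc_S _ _ _ _ t1 t2, xbc_S _ _ _ _ t1 t2]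
      constructor <;> split_ifs <;> omega

theorem eS (hn : 2 ≤ n) (l p q j : ℕ) (h1 : 1 ≤ j) (h2 : j < 2 * n) :
    eC n l (nd n j) (S n p q (j + 1)) = some (S n p q j) := by
  have hi : 1 ≤ nd n j ∧ nd n j ≤ n ∧ (nd n j = j ∨ (n < j ∧ nd n j = 2 * n - j)) := by
    unfold nd; split_ifs <;> omega
  generalize nd n j = i at hi ⊢
  obtain ⟨i1, i2, i3⟩ := hi
  have h0 : i ≠ 0 := by omega
  simp only [eC, h0, if_false]
  by_cases hin : i = n
  · subst hin
    have hj : j = i := by omega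
    subst hj
    simp only [xc_S _ _ _ _ h1 le_rfl, xbc_S _ _ _ _ h1 le_rfl, if_true]
    rw [if_pos (by split_ifs <;> omega)]
    congr 1
    apply tup_ext
    intro t t1 t2
    rw [xc_setx _ _ _ _ _ t1 t2, xbc_setx _ _ _ _ _ t1 t2, xc_fst, xbc_snd]
    simp only [xc_S _ _ _ _ t1 t2, xbc_S _ _ _ _ t1 t2]
    constructor <;> split_ifs <;> omega
  · have hin' : i < n := by omega
    simp only [hin, hin', if_true, if_false, xc_S _ _ _ _ i1 i2, xbc_S _ _ _ _ i1 i2,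
      xc_S _ _ _ (i + 1) (by omega) hin', xbc_S _ _ _ (i + 1) (by omega) hin']
    rcases i3 with hj | ⟨hj, hj'⟩
    · subst hj
      rw [if_pos (by split_ifs <;> omega)]
      congr 1
      apply tup_ext
      intro t t1 t2
      rw [xc_setx _ _ _ _ _ t1 t2, xc_setx _ _ _ _ _ t1 t2, xc_fst, xbc_snd]
      simp only [xc_S _ _ _ _ t1 t2, xbc_S _ _ _ _ t1 t2]
      constructor <;> split_ifs <;> omega
    · rw [if_neg (by split_ifs <;> omega), if_pos (by split_ifs <;> omega)]
      congr 1
      apply tup_ext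
      intro t t1 t2
      rw [xbc_setx _ _ _ _ _ t1 t2, xbc_setx _ _ _ _ _ t1 t2, xc_fst, xbc_snd]
      simp only [xc_S _ _ _ _ t1 t2, xbc_S _ _ _ _ t1 t2]
      constructor <;> split_ifs <;> omega

end basics

section tens
variable {n : ℕ}

theorem S_one (hn : 2 ≤ n) (p q : ℕ) : S n p q 1 = tripleVec n (p + 1) 0 q := by
  apply tup_ext
  intro t t1 t2
  simp only [xc_S _ _ _ _ t1 t2, xbc_S _ _ _ _ t1 t2, xc_T _ _ _ _ t1 t2, xbc_T _ _ _ _ t1 t2]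
  constructor <;> split_ifs <;> omega

theorem S_last (hn : 2 ≤ n) (p q : ℕ) : S n p q (2 * n) = tripleVec n p 0 (q + 1) := by
  apply tup_ext
  intro t t1 t2
  simp only [xc_S _ _ _ _ t1 t2, xbc_S _ _ _ _ t1 t2, xc_T _ _ _ _ t1 t2, xbc_T _ _ _ _ t1 t2]
  constructor <;> split_ifs <;> omega

theorem uvec_eq (v : ℕ) : uvec n v = tripleVec n v 0 0 := by
  simp [uvec, tripleVec]

theorem u2vec_eq (v : ℕ) : u2vec n v = tripleVec n 0 v 0 := by
  unfold u2vec tripleVec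
  congr 1
  · funext j; split_ifs <;> omega
  · funext j; simp

theorem gi_T (a i : ℕ) (h1 : 1 ≤ i) (h2 : i ≤ n) : gi n i (tripleVec n a 0 0) = 0 := by
  unfold gi
  split_ifs with h
  · rw [xbc_T _ _ _ _ (by omega) (by omega)]; simp
  · rw [xbc_T _ _ _ _ (by omega) (by omega), xc_T _ _ _ _ (by omega) (by omega)]
    split_ifs <;> omega

theorem pi_T (d i : ℕ) (h1 : 1 ≤ i) (h2 : i ≤ n) : pi' n i (tripleVec n 0 0 d) = 0 := by
  unfold pi'
  split_ifs with h
  · rw [xc_T _ _ _ _ (by omega) (by omega)]; simp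
  · rw [xbc_T _ _ _ _ (by omega) (by omega), xc_T _ _ _ _ (by omega) (by omega)]
    split_ifs <;> omega

theorem pi_pos (l i : ℕ) (h1 : 1 ≤ i) (h2 : i ≤ n) (b b' : Tup n) (h : fC n l i b = some b') :
    0 < pi' n i b := by
  by_contra hc
  have h0 : i ≠ 0 := by omega
  simp only [fC, h0, if_false] at h
  unfold pi' at hc
  split_ifs at h hc <;> omega

theorem gi_pos (l i : ℕ) (h1 : 1 ≤ i) (h2 : i ≤ n) (b b' : Tup n) (h : eC n l i b = some b') :
    0 < gi n i b := by
  by_contra hc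
  have h0 : i ≠ 0 := by omega
  simp only [eC, h0, if_false] at h
  unfold gi at hc
  split_ifs at h hc <;> omega

theorem fL (l k i : ℕ) (h1 : 1 ≤ i) (h2 : i ≤ n) (b b' : Tup n) (a : ℕ)
    (h : fC n l i b = some b') :
    fTenC n l k i (b, tripleVec n a 0 0) = some (b', tripleVec n a 0 0) := by
  unfold fTenC
  simp only [eps_eq k i h1 h2, phi_eq l i h1 h2, gi_T a i h1 h2]
  rw [if_pos (pi_pos l i h1 h2 b b' h), h]; rfl

theorem fR (l k i : ℕ) (h1 : 1 ≤ i) (h2 : i ≤ n) (b b' : Tup n) (d : ℕ)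
    (h : fC n k i b = some b') :
    fTenC n l k i (tripleVec n 0 0 d, b) = some (tripleVec n 0 0 d, b') := by
  unfold fTenC
  simp only [phi_eq l i h1 h2, pi_T d i h1 h2]
  rw [if_neg (by omega), h]; rfl

theorem eR (l k i : ℕ) (h1 : 1 ≤ i) (h2 : i ≤ n) (b b' : Tup n) (d : ℕ)
    (h : eC n k i b = some b') :
    eTenC n l k i (tripleVec n 0 0 d, b) = some (tripleVec n 0 0 d, b') := by
  unfold eTenC
  have := gi_pos k i h1 h2 b b' h
  simp only [phi_eq l i h1 h2, pi_T d i h1 h2, eps_eq k i h1 h2]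
  rw [if_neg (by omega), h]; rfl

theorem nd_pos (j : ℕ) (h1 : 1 ≤ j) (h2 : j < 2 * n) : 1 ≤ nd n j ∧ nd n j ≤ n := by
  unfold nd; split_ifs <;> omega

theorem mem_T (hn : 2 ≤ n) (l a c d : ℕ) (h : a + c + d ≤ l) (h' : (l - (a + c + d)) % 2 = 0) :
    tripleVec n a c d ∈ BC n l := by
  refine ⟨?_, ?_⟩ <;> rw [tsum_T hn] <;> assumption

theorem mem_S (hn : 2 ≤ n) (p q j : ℕ) (h1 : 1 ≤ j) (h2 : j ≤ 2 * n) (l : ℕ)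
    (hl : l = p + q + 1) : S n p q j ∈ BC n l := by
  subst hl
  refine ⟨?_, ?_⟩ <;> rw [tsum_S hn _ _ _ h1 h2]
  simp

/-- 0-string -/
def V (n a c D j : ℕ) : Tup n := tripleVec n (a + (2 * j - (D - a))) c (a + ((D - a) - 2 * j))

theorem fV (hn : 2 ≤ n) (m a c D j : ℕ) (h : a ≤ D) (hj : j < D - a) (hm : m = a + c + D) :
    fC n m 0 (V n a c D j) = some (V n a c D (j + 1)) := by
  have hn1 : 1 ≤ n := by omega
  have h0 : 0 < n := by omega
  unfold V
  simp only [fC, if_true, h0]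
  rw [tsum_T hn, xc_T _ _ _ _ le_rfl hn1, xbc_T _ _ _ _ le_rfl hn1]
  simp only [if_true]
  split_ifs with c1 c2 c3
  · congr 1
    apply tup_ext
    intro t t1 t2
    rw [xc_setx _ _ _ _ _ t1 t2, xc_fst, xbc_snd]
    simp only [xc_T _ _ _ _ t1 t2, xbc_T _ _ _ _ t1 t2]
    constructor <;> split_ifs <;> omega
  · omega
  · congr 1
    apply tup_ext
    intro t t1 t2
    rw [xc_setx _ _ _ _ _ t1 t2, xbc_setx _ _ _ _ _ t1 t2, xc_fst, xbc_snd]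
    simp only [xc_T _ _ _ _ t1 t2, xbc_T _ _ _ _ t1 t2]
    constructor <;> split_ifs <;> omega
  · congr 1
    apply tup_ext
    intro t t1 t2
    rw [xbc_setx _ _ _ _ _ t1 t2, xc_fst, xbc_snd]
    simp only [xc_T _ _ _ _ t1 t2, xbc_T _ _ _ _ t1 t2]
    constructor <;> split_ifs <;> omega

theorem eV (hn : 2 ≤ n) (m a c D j : ℕ) (h : a ≤ D) (hj : j < D - a) (hm : m = a + c + D) :
    eC n m 0 (V n a c D (j + 1)) = some (V n a c D j) := by
  have hn1 : 1 ≤ n := by omega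
  have h0 : 0 < n := by omega
  unfold V
  simp only [eC, if_true, h0]
  rw [tsum_T hn, xc_T _ _ _ _ le_rfl hn1, xbc_T _ _ _ _ le_rfl hn1]
  simp only [if_true]
  split_ifs with c1 c2 c3
  · congr 1
    apply tup_ext
    intro t t1 t2
    rw [xc_setx _ _ _ _ _ t1 t2, xc_fst, xbc_snd]
    simp only [xc_T _ _ _ _ t1 t2, xbc_T _ _ _ _ t1 t2]
    constructor <;> split_ifs <;> omega
  · congr 1
    apply tup_ext
    intro t t1 t2
    rw [xc_setx _ _ _ _ _ t1 t2, xbc_setx _ _ _ _ _ t1 t2, xc_fst, xbc_snd]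
    simp only [xc_T _ _ _ _ t1 t2, xbc_T _ _ _ _ t1 t2]
    constructor <;> split_ifs <;> omega
  · congr 1
    apply tup_ext
    intro t t1 t2
    rw [xbc_setx _ _ _ _ _ t1 t2, xc_fst, xbc_snd]
    simp only [xc_T _ _ _ _ t1 t2, xbc_T _ _ _ _ t1 t2]
    constructor <;> split_ifs <;> omega
  · omega

theorem eps_T (hn : 2 ≤ n) (m a c d : ℕ) (h : a + c + d ≤ m) :
    epsC n m 0 (tripleVec n a c d) = (m - (a + c + d)) / 2 + (a - d) := by
  have hn1 : 1 ≤ n := by omega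
  rw [eps0_eq hn m _ (by rw [tsum_T hn]; exact h), g0, tsum_T hn, xc_T _ _ _ _ le_rfl hn1,
    xbc_T _ _ _ _ le_rfl hn1]
  simp

theorem phi_T (hn : 2 ≤ n) (m a c d : ℕ) (h : a + c + d ≤ m) :
    phiC n m 0 (tripleVec n a c d) = (m - (a + c + d)) / 2 + (d - a) := by
  have hn1 : 1 ≤ n := by omega
  rw [phi0_eq hn m _ (by rw [tsum_T hn]; exact h), p0, tsum_T hn, xc_T _ _ _ _ le_rfl hn1,
    xbc_T _ _ _ _ le_rfl hn1]
  simp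

theorem eps_V (hn : 2 ≤ n) (m a c D j : ℕ) (h : a ≤ D) (hj : j ≤ D - a) (hm : m = a + c + D) :
    epsC n m 0 (V n a c D j) = j := by
  rw [V, eps_T hn _ _ _ _ (by omega)]; omega

theorem phi_V (hn : 2 ≤ n) (m a c D j : ℕ) (h : a ≤ D) (hj : j ≤ D - a) (hm : m = a + c + D) :
    phiC n m 0 (V n a c D j) = D - a - j := by
  rw [V, phi_T hn _ _ _ _ (by omega)]; omega

theorem mem_V (hn : 2 ≤ n) (m a c D j : ℕ) (h : a ≤ D) (hj : j ≤ D - a) (hm : m = a + c + D) :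
    V n a c D j ∈ BC n m := by
  apply mem_T hn <;> omega

theorem V_zero (a c D : ℕ) (h : a ≤ D) : V n a c D 0 = tripleVec n a c D := by
  unfold V; congr 1 <;> omega

theorem V_top (D : ℕ) : V n 0 0 D D = tripleVec n D 0 0 := by
  unfold V; congr 1 <;> omega

/-- chains of `e_0` -/
def EChain (n l k : ℕ) : ℕ → Tup n × Tup n → Prop
  | 0, _ => True
  | m + 1, u => ∃ v, eTenC n l k 0 u = some v ∧ EChain n l k m v

theorem tsum_e (hn : 2 ≤ n) (l k m : ℕ) (u : Tup n × Tup n) (h1 : tsum u.1 ≤ l)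
    (h2 : tsum u.2 ≤ k) (h : EChain n l k m u) : m ≤ g0 l u.1 + g0 k u.2 := by
  induction m generalizing u with
  | zero => omega
  | succ m ih =>
    obtain ⟨v, hv, hc⟩ := h
    unfold eTenC at hv
    split_ifs at hv
    · rw [Option.map_eq_some_iff] at hv
      obtain ⟨b, hb, rfl⟩ := hv
      have s := e0_step hn l _ _ h1 hb
      have := ih (b, u.2) s.1 h2 hc
      simp only at this
      omega
    · rw [Option.map_eq_some_iff] at hv
      obtain ⟨b, hb, rfl⟩ := hv
      have s := e0_step hn k _ _ h2 hb
      have := ih (u.1, b) h1 s.1 hc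
      simp only at this
      omega

theorem e0_mem (hn : 2 ≤ n) (l : ℕ) (b b' : Tup n) (hb : b ∈ BC n l)
    (h : eC n l 0 b = some b') : b' ∈ BC n l := by
  have hx := x1_le hn b
  have hn1 : 1 ≤ n := by omega
  obtain ⟨s1, s2⟩ := e0_step hn l b b' hb.1 h
  obtain ⟨m1, m2⟩ := hb
  refine ⟨s1, ?_⟩
  obtain ⟨f, g⟩ := b
  unfold eC at h
  have h0 : 0 < n := by omega
  simp only [if_true, h0] at h
  split_ifs at h with c1 c2 c3
  · simp only [Option.some.injEq] at h
    subst h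
    have t1 := tsum_setx1 f g 1 (xc ((f, g) : Tup n) 1 - 2) le_rfl hn1
    omega
  · simp only [Option.some.injEq] at h
    subst h
    have t1 := tsum_setx1 f g 1 (xc ((f, g) : Tup n) 1 - 1) le_rfl hn1
    have t2 := tsum_setx2 g (setx f 1 (xc ((f, g) : Tup n) 1 - 1)) 1 (xbc ((f, g) : Tup n) 1 + 1)
      le_rfl hn1
    have : xbc ((setx f 1 (xc ((f, g) : Tup n) 1 - 1), g) : Tup n) 1 = xbc ((f, g) : Tup n) 1 := rfl
    rw [this] at t2
    omega
  · simp only [Option.some.injEq] at h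
    subst h
    have t1 := tsum_setx2 g f 1 (xbc ((f, g) : Tup n) 1 + 2) le_rfl hn1
    omega

theorem chain_iso (hn : 2 ≤ n) (l k m : ℕ) (ι : Tup n × Tup n → Tup n × Tup n)
    (hι : IsIsoC n l k ι) (u : Tup n × Tup n) (hu : u ∈ BC n l ×ˢ BC n k)
    (h : EChain n l k m u) : EChain n k l m (ι u) := by
  induction m generalizing u with
  | zero => trivial
  | succ m ih =>
    obtain ⟨v, hv, hc⟩ := h
    have hs := (hι.2 u hu 0 (by omega)).1
    have hm : v ∈ BC n l ×ˢ BC n k := by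
      unfold eTenC at hv
      split_ifs at hv
      · rw [Option.map_eq_some_iff] at hv
        obtain ⟨b, hb, rfl⟩ := hv
        exact ⟨e0_mem hn l _ _ hu.1 hb, hu.2⟩
      · rw [Option.map_eq_some_iff] at hv
        obtain ⟨b, hb, rfl⟩ := hv
        exact ⟨hu.1, e0_mem hn k _ _ hu.2 hb⟩
    refine ⟨ι v, ?_, ih v hm hc⟩
    rw [← hs, hv]; rfl

theorem chain_src (hn : 2 ≤ n) (l k : ℕ) :
    EChain n l k (k + l) (tripleVec n l 0 0, tripleVec n k 0 0) := by
  have A : ∀ j, j ≤ l → EChain n l k j (V n 0 0 l j, V n 0 0 k 0) := by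
    intro j
    induction j with
    | zero => intro _; trivial
    | succ j ih =>
      intro hj
      refine ⟨_, ?_, ih (by omega)⟩
      unfold eTenC
      simp only
      rw [eps_V hn k _ _ _ _ (by omega) (by omega) (by omega), if_pos (by omega),
        eV hn l _ _ _ _ (by omega) (by omega) (by omega)]
      rfl
  have B : ∀ j, j ≤ k → EChain n l k (j + l) (V n 0 0 l l, V n 0 0 k j) := by
    intro j
    induction j with
    | zero => intro _; simpa using A l le_rfl
    | succ j ih =>
      intro hj
      rw [show j + 1 + l = (j + l) + 1 by omega]
      refine ⟨_, ?_, ih (by omega)⟩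
      unfold eTenC
      simp only
      rw [eps_V hn k _ _ _ _ (by omega) (by omega) (by omega),
        phi_V hn l _ _ _ _ (by omega) (by omega) (by omega), if_neg (by omega),
        eV hn k _ _ _ _ (by omega) (by omega) (by omega)]
      rfl
  have := B k le_rfl
  rwa [V_top, V_top] at this

theorem g0_top (hn : 2 ≤ n) (l : ℕ) (b : Tup n) (h : tsum b ≤ l) :
    g0 l b ≤ l ∧ (l ≤ g0 l b → b = tripleVec n l 0 0) := by
  have hx := x1_le hn b
  have hn1 : 1 ≤ n := by omega
  unfold g0
  refine ⟨by omega, fun hl => ?_⟩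
  have e1 : xc b 1 = l := by omega
  have e2 : tsum b = l := by omega
  have t := tsum_setx1 b.1 b.2 1 0 le_rfl hn1
  have e3 : tsum ((b.1, b.2) : Tup n) = l := e2
  rw [xc_fst, e1, e3] at t
  have t0 : tsum ((setx b.1 1 0, b.2) : Tup n) = 0 := by omega
  rw [tsum_mk] at t0
  have t1 : ∑ t, setx b.1 1 0 t = 0 := by omega
  have t2 : ∑ t, b.2 t = 0 := by omega
  rw [Finset.sum_eq_zero_iff] at t1 t2
  apply tup_ext
  intro i h1 h2
  rw [xc_T _ _ _ _ h1 h2, xbc_T _ _ _ _ h1 h2]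
  have hi : i - 1 < n := by omega
  have r1 := t1 ⟨i - 1, hi⟩ (Finset.mem_univ _)
  have r2 := t2 ⟨i - 1, hi⟩ (Finset.mem_univ _)
  constructor
  · by_cases h : i = 1
    · subst h; simpa using e1
    · simp only [setx] at r1
      rw [if_neg (by omega)] at r1
      simp only [xc, hi, dite_true, r1, h, if_false]
      simp
  · simp only [xbc, hi, dite_true, r2]
    simp

theorem anchor (hn : 2 ≤ n) (l k : ℕ) (ι : Tup n × Tup n → Tup n × Tup n)
    (hι : IsIsoC n l k ι) :
    ι (tripleVec n l 0 0, tripleVec n k 0 0) = (tripleVec n k 0 0, tripleVec n l 0 0) := by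
  have hu : ((tripleVec n l 0 0, tripleVec n k 0 0) : Tup n × Tup n) ∈ BC n l ×ˢ BC n k :=
    ⟨mem_T hn _ _ _ _ (by omega) (by omega), mem_T hn _ _ _ _ (by omega) (by omega)⟩
  have hc := chain_iso hn l k _ ι hι _ hu (chain_src hn l k)
  have hm := hι.1.mapsTo hu
  have := tsum_e hn k l _ _ hm.1.1 hm.2.1 hc
  have a1 := g0_top hn k _ hm.1.1
  have a2 := g0_top hn l _ hm.2.1
  exact Prod.ext (a1.2 (by omega)) (a2.2 (by omega))

theorem stepι (l k i : ℕ) (ι : Tup n × Tup n → Tup n × Tup n)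
    (hι : IsIsoC n l k ι) (hi : i ≤ n) (u u' v v' : Tup n × Tup n) (hu : u ∈ BC n l ×ˢ BC n k)
    (h : ι u = u') (hf : fTenC n l k i u = some v) (hf' : fTenC n k l i u' = some v') :
    ι v = v' := by
  have := (hι.2 u hu i hi).2
  rw [h, hf, hf'] at this
  simpa using this

theorem passι (hn : 2 ≤ n) (l k : ℕ) (ι : Tup n × Tup n → Tup n × Tup n)
    (hι : IsIsoC n l k ι) (A A' : ℕ → Tup n × Tup n)
    (hA : ∀ j, 1 ≤ j → j ≤ 2 * n → A j ∈ BC n l ×ˢ BC n k)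
    (hf : ∀ j, 1 ≤ j → j < 2 * n → fTenC n l k (nd n j) (A j) = some (A (j + 1)))
    (hf' : ∀ j, 1 ≤ j → j < 2 * n → fTenC n k l (nd n j) (A' j) = some (A' (j + 1)))
    (h : ι (A 1) = A' 1) : ι (A (2 * n)) = A' (2 * n) := by
  have : ∀ j, 1 ≤ j → j ≤ 2 * n → ι (A j) = A' j := by
    intro j h1
    induction j, h1 using Nat.le_induction with
    | base => intro _; exact h
    | succ j h1 ih =>
      intro hj
      exact stepι l k _ ι hι (nd_pos j h1 (by omega)).2 _ _ _ _ (hA j h1 (by omega))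
        (ih (by omega)) (hf j h1 (by omega)) (hf' j h1 (by omega))
  exact this _ (by omega) le_rfl

theorem passH (hn : 2 ≤ n) (l k : ℕ) (ι : Tup n × Tup n → Tup n × Tup n)
    (H : Tup n × Tup n → ℤ) (hH : IsEnergyC n l k ι H) (A : ℕ → Tup n × Tup n)
    (hA : ∀ j, 1 ≤ j → j ≤ 2 * n → A j ∈ BC n l ×ˢ BC n k)
    (he : ∀ j, 1 ≤ j → j < 2 * n → eTenC n l k (nd n j) (A (j + 1)) = some (A j)) :
    H (A (2 * n)) = H (A 1) := by
  have : ∀ j, 1 ≤ j → j ≤ 2 * n → H (A j) = H (A 1) := by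
    intro j h1
    induction j, h1 using Nat.le_induction with
    | base => intro _; rfl
    | succ j h1 ih =>
      intro hj
      have hp := nd_pos j h1 (show j < 2 * n by omega)
      have := hH.1 _ (hA (j + 1) (by omega) hj) _ hp.2 _ (he j h1 (by omega))
      rw [if_neg (by omega), ih (by omega)] at this
      omega
  exact this _ (by omega) le_rfl

theorem stage1 (hn : 2 ≤ n) (l k : ℕ) (hkl : k ≤ l) (ι : Tup n × Tup n → Tup n × Tup n)
    (hι : IsIsoC n l k ι) (m : ℕ) (hm : m ≤ l) :
    ι (tripleVec n (l - m) 0 m, tripleVec n k 0 0) =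
      (tripleVec n (k - m) 0 (min m k), tripleVec n (l - (m - k)) 0 (m - k)) := by
  induction m with
  | zero => simpa using anchor hn l k ι hι
  | succ m ih =>
    have ih := ih (by omega)
    obtain ⟨L, rfl⟩ : ∃ L, l = L + 1 + m := ⟨l - (m + 1), by omega⟩
    rw [show L + 1 + m - m = L + 1 by omega, ← S_one hn] at ih
    rw [show L + 1 + m - (m + 1) = L by omega, ← S_last hn]
    by_cases hmk : m < k
    · obtain ⟨K, rfl⟩ : ∃ K, k = K + 1 + m := ⟨k - (m + 1), by omega⟩
      rw [show K + 1 + m - m = K + 1 by omega, show min m (K + 1 + m) = m by omega,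
        ← S_one hn, show m - (K + 1 + m) = 0 by omega] at ih
      rw [show K + 1 + m - (m + 1) = K by omega, show min (m + 1) (K + 1 + m) = m + 1 by omega,
        ← S_last hn, show m + 1 - (K + 1 + m) = 0 by omega]
      refine passι hn _ _ ι hι (fun j => (S n L m j, tripleVec n (K + 1 + m) 0 0))
        (fun j => (S n K m j, tripleVec n (L + 1 + m - 0) 0 0)) ?_ ?_ ?_ ih
      · intro j h1 h2
        exact ⟨mem_S hn _ _ _ h1 h2 _ (by omega), mem_T hn _ _ _ _ (by omega) (by omega)⟩
      · intro j h1 h2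
        have hp := nd_pos j h1 h2
        exact fL _ _ _ hp.1 hp.2 _ _ _ (fS hn _ _ _ _ h1 h2)
      · intro j h1 h2
        have hp := nd_pos j h1 h2
        exact fL _ _ _ hp.1 hp.2 _ _ _ (fS hn _ _ _ _ h1 h2)
    · obtain ⟨r, rfl⟩ : ∃ r, m = k + r := ⟨m - k, by omega⟩
      rw [show k - (k + r) = 0 by omega, show min (k + r) k = k by omega,
        show L + 1 + (k + r) - (k + r - k) = (L + k) + 1 by omega, show k + r - k = r by omega,
        ← S_one hn] at ih
      rw [show k - (k + r + 1) = 0 by omega, show min (k + r + 1) k = k by omega,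
        show L + 1 + (k + r) - (k + r + 1 - k) = L + k by omega,
        show k + r + 1 - k = r + 1 by omega, ← S_last hn]
      refine passι hn _ _ ι hι (fun j => (S n L (k + r) j, tripleVec n k 0 0))
        (fun j => (tripleVec n 0 0 k, S n (L + k) r j)) ?_ ?_ ?_ ih
      · intro j h1 h2
        exact ⟨mem_S hn _ _ _ h1 h2 _ (by omega), mem_T hn _ _ _ _ (by omega) (by omega)⟩
      · intro j h1 h2
        have hp := nd_pos j h1 h2
        exact fL _ _ _ hp.1 hp.2 _ _ _ (fS hn _ _ _ _ h1 h2)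
      · intro j h1 h2
        have hp := nd_pos j h1 h2
        exact fR _ _ _ hp.1 hp.2 _ _ _ (fS hn _ _ _ _ h1 h2)

theorem stage2 (hn : 2 ≤ n) (l k : ℕ) (hkl : k ≤ l) (ι : Tup n × Tup n → Tup n × Tup n)
    (hι : IsIsoC n l k ι) (H : Tup n × Tup n → ℤ) (hH : IsEnergyC n l k ι H)
    (m : ℕ) (hm : m ≤ k) :
    ι (tripleVec n 0 0 l, tripleVec n (k - m) 0 m) =
      (tripleVec n 0 0 k, tripleVec n (k - m) 0 (m + (l - k))) ∧
    H (tripleVec n 0 0 l, tripleVec n (k - m) 0 m) =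
      H (tripleVec n 0 0 l, tripleVec n k 0 0) := by
  induction m with
  | zero =>
    refine ⟨?_, rfl⟩
    have := stage1 hn l k hkl ι hι l le_rfl
    rw [show l - l = 0 by omega, show k - l = 0 by omega, show min l k = k by omega,
      show l - (l - k) = k by omega] at this
    simpa using this
  | succ m ih =>
    obtain ⟨ih, ihH⟩ := ih (by omega)
    obtain ⟨K, rfl⟩ : ∃ K, k = K + 1 + m := ⟨k - (m + 1), by omega⟩
    rw [show K + 1 + m - m = K + 1 by omega, ← S_one hn] at ih ihH
    rw [← S_one hn] at ih
    rw [show K + 1 + m - (m + 1) = K by omega,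
      show m + 1 + (l - (K + 1 + m)) = m + (l - (K + 1 + m)) + 1 by omega, ← S_last hn,
      ← S_last hn]
    have hA : ∀ j, 1 ≤ j → j ≤ 2 * n →
        ((tripleVec n 0 0 l, S n K m j) : Tup n × Tup n) ∈ BC n l ×ˢ BC n (K + 1 + m) := by
      intro j h1 h2
      exact ⟨mem_T hn _ _ _ _ (by omega) (by omega), mem_S hn _ _ _ h1 h2 _ (by omega)⟩
    constructor
    · refine passι hn _ _ ι hι (fun j => (tripleVec n 0 0 l, S n K m j))
        (fun j => (tripleVec n 0 0 (K + 1 + m), S n K (m + (l - (K + 1 + m))) j)) hA ?_ ?_ ih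
      · intro j h1 h2
        have hp := nd_pos j h1 h2
        exact fR _ _ _ hp.1 hp.2 _ _ _ (fS hn _ _ _ _ h1 h2)
      · intro j h1 h2
        have hp := nd_pos j h1 h2
        exact fR _ _ _ hp.1 hp.2 _ _ _ (fS hn _ _ _ _ h1 h2)
    · rw [← ihH]
      refine passH hn _ _ ι H hH (fun j => (tripleVec n 0 0 l, S n K m j)) hA ?_
      intro j h1 h2
      have hp := nd_pos j h1 h2
      exact eR _ _ _ hp.1 hp.2 _ _ _ (eS hn _ _ _ _ h1 h2)

theorem f1T (hn : 2 ≤ n) (m a c d : ℕ) :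
    fC n m 1 (tripleVec n (a + 1) c d) = some (tripleVec n a (c + 1) d) := by
  have hn1 : 1 ≤ n := by omega
  have q1 : ¬ (1 = n) := by omega
  have q2 : 1 < n := by omega
  simp only [fC, q1, q2, if_true, if_false, one_ne_zero, xc_T _ _ _ 1 le_rfl hn1,
    xc_T _ _ _ (1 + 1) (by omega) hn, xbc_T _ _ _ (1 + 1) (by omega) hn]
  rw [if_pos (by simp), if_pos (by omega)]
  congr 1
  apply tup_ext
  intro t t1 t2
  rw [xc_setx _ _ _ _ _ t1 t2, xc_setx _ _ _ _ _ t1 t2, xc_fst, xbc_snd]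
  simp only [xc_T _ _ _ _ t1 t2, xbc_T _ _ _ _ t1 t2]
  refine ⟨?_, by simp⟩
  split_ifs <;> omega

theorem e1T (hn : 2 ≤ n) (m a c d : ℕ) :
    eC n m 1 (tripleVec n a (c + 1) d) = some (tripleVec n (a + 1) c d) := by
  have hn1 : 1 ≤ n := by omega
  have q1 : ¬ (1 = n) := by omega
  have q2 : 1 < n := by omega
  simp only [eC, q1, q2, if_true, if_false, one_ne_zero, xc_T _ _ _ 1 le_rfl hn1,
    xc_T _ _ _ (1 + 1) (by omega) hn, xbc_T _ _ _ (1 + 1) (by omega) hn]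
  rw [if_pos (by simp)]
  congr 1
  apply tup_ext
  intro t t1 t2
  rw [xc_setx _ _ _ _ _ t1 t2, xc_setx _ _ _ _ _ t1 t2, xc_fst, xbc_snd]
  simp only [xc_T _ _ _ _ t1 t2, xbc_T _ _ _ _ t1 t2]
  refine ⟨?_, by simp⟩
  split_ifs <;> omega

theorem stage3 (hn : 2 ≤ n) (l k : ℕ) (hkl : k ≤ l) (ι : Tup n × Tup n → Tup n × Tup n)
    (hι : IsIsoC n l k ι) (H : Tup n × Tup n → ℤ) (hH : IsEnergyC n l k ι H)
    (c a d : ℕ) (h : a + c + d = k) :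
    ι (tripleVec n 0 0 l, tripleVec n a c d) =
      (tripleVec n 0 0 k, tripleVec n a c (d + (l - k))) ∧
    H (tripleVec n 0 0 l, tripleVec n a c d) =
      H (tripleVec n 0 0 l, tripleVec n k 0 0) := by
  induction c generalizing a with
  | zero =>
    have := stage2 hn l k hkl ι hι H hH d (by omega)
    rwa [show k - d = a by omega] at this
  | succ c ih =>
    obtain ⟨ih, ihH⟩ := ih (a + 1) (by omega)
    have hm : ∀ a c : ℕ, a + c + d = k → ((tripleVec n 0 0 l, tripleVec n a c d) : Tup n × Tup n)
        ∈ BC n l ×ˢ BC n k := fun a c h =>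
      ⟨mem_T hn _ _ _ _ (by omega) (by omega), mem_T hn _ _ _ _ (by omega) (by omega)⟩
    constructor
    · exact stepι l k 1 ι hι (by omega) _ _ _ _ (hm (a + 1) c (by omega)) ih
        (fR _ _ _ le_rfl (by omega) _ _ _ (f1T hn _ _ _ _))
        (fR _ _ _ le_rfl (by omega) _ _ _ (f1T hn _ _ _ _))
    · have := hH.1 _ (hm a (c + 1) (by omega)) 1 (by omega) _
        (eR _ _ _ le_rfl (by omega) _ _ _ (e1T hn _ _ _ _))
      rw [if_neg (by omega), ihH] at this
      omega

theorem stage4 (hn : 2 ≤ n) (l k : ℕ) (hkl : k ≤ l) (ι : Tup n × Tup n → Tup n × Tup n)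
    (hι : IsIsoC n l k ι) (H : Tup n × Tup n → ℤ) (hH : IsEnergyC n l k ι H)
    (c a d : ℕ) (h : a + c + d = k) (had : a ≤ d + (l - k)) (j : ℕ) (hj : j ≤ k) :
    ι (V n 0 0 l j, tripleVec n a c d) =
      (V n 0 0 k j, tripleVec n a c (d + (l - k))) ∧
    H (V n 0 0 l j, tripleVec n a c d) =
      H (tripleVec n 0 0 l, tripleVec n k 0 0) - j := by
  induction j with
  | zero =>
    rw [V_zero _ _ _ (by omega), V_zero _ _ _ (by omega)]
    simpa using stage3 hn l k hkl ι hι H hH c a d h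
  | succ j ih =>
    obtain ⟨ih, ihH⟩ := ih (by omega)
    have hm : ∀ j : ℕ, j ≤ l → ((V n 0 0 l j, tripleVec n a c d) : Tup n × Tup n)
        ∈ BC n l ×ˢ BC n k := fun j h =>
      ⟨mem_V hn _ _ _ _ _ (by omega) (by omega) (by omega),
        mem_T hn _ _ _ _ (by omega) (by omega)⟩
    have hι' : ι (V n 0 0 l (j + 1), tripleVec n a c d) =
      (V n 0 0 k (j + 1), tripleVec n a c (d + (l - k))) := by
      refine stepι l k 0 ι hι (by omega) _ _ _ _ (hm j (by omega)) ih ?_ ?_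
      · unfold fTenC
        simp only
        rw [phi_V hn _ _ _ _ _ (by omega) (by omega) (by omega), eps_T hn _ _ _ _ (by omega),
          if_pos (by omega), fV hn _ _ _ _ _ (by omega) (by omega) (by omega)]
        rfl
      · unfold fTenC
        simp only
        rw [phi_V hn _ _ _ _ _ (by omega) (by omega) (by omega), eps_T hn _ _ _ _ (by omega),
          if_pos (by omega), fV hn _ _ _ _ _ (by omega) (by omega) (by omega)]
        rfl
    refine ⟨hι', ?_⟩
    have he : eTenC n l k 0 (V n 0 0 l (j + 1), tripleVec n a c d) =
        some (V n 0 0 l j, tripleVec n a c d) := by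
      unfold eTenC
      simp only
      rw [phi_V hn _ _ _ _ _ (by omega) (by omega) (by omega), eps_T hn _ _ _ _ (by omega),
          if_pos (by omega), eV hn _ _ _ _ _ (by omega) (by omega) (by omega)]
      rfl
    have := hH.1 _ (hm (j + 1) (by omega)) 0 (by omega) _ he
    rw [hι'] at this
    simp only [if_true] at this
    rw [phi_V hn _ _ _ _ _ (by omega) (by omega) (by omega), eps_T hn _ _ _ _ (by omega),
      phi_V hn _ _ _ _ _ (by omega) (by omega) (by omega), eps_T hn _ _ _ _ (by omega),
      if_pos (by omega), ihH] at this
    push_cast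
    omega

theorem stage5 (hn : 2 ≤ n) (l k : ℕ) (hkl : k ≤ l) (ι : Tup n × Tup n → Tup n × Tup n)
    (hι : IsIsoC n l k ι) (H : Tup n × Tup n → ℤ) (hH : IsEnergyC n l k ι H)
    (c a d : ℕ) (h : a + c + d = k) (had : a ≤ d + (l - k)) (j : ℕ)
    (hj : j ≤ l - k) (hj' : a + j ≤ d + (l - k)) :
    ι (V n 0 0 l (k + j), tripleVec n a c d) =
      (tripleVec n k 0 0, V n a c (d + (l - k)) j) ∧
    H (V n 0 0 l (k + j), tripleVec n a c d) =
      H (tripleVec n 0 0 l, tripleVec n k 0 0) - k := by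
  induction j with
  | zero =>
    rw [V_zero _ _ _ had]
    have := stage4 hn l k hkl ι hι H hH c a d h had k le_rfl
    rwa [V_top k] at this
  | succ j ih =>
    obtain ⟨ih, ihH⟩ := ih (by omega) (by omega)
    rw [← add_assoc]
    have hm : ∀ j : ℕ, j ≤ l → ((V n 0 0 l j, tripleVec n a c d) : Tup n × Tup n)
        ∈ BC n l ×ˢ BC n k := fun j h =>
      ⟨mem_V hn _ _ _ _ _ (by omega) (by omega) (by omega),
        mem_T hn _ _ _ _ (by omega) (by omega)⟩
    have hι' : ι (V n 0 0 l (k + j + 1), tripleVec n a c d) =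
      (tripleVec n k 0 0, V n a c (d + (l - k)) (j + 1)) := by
      refine stepι l k 0 ι hι (by omega) _ _ _ _ (hm (k + j) (by omega)) ih ?_ ?_
      · unfold fTenC
        simp only
        rw [phi_V hn _ _ _ _ _ (by omega) (by omega) (by omega), eps_T hn _ _ _ _ (by omega),
          if_pos (by omega), fV hn _ _ _ _ _ (by omega) (by omega) (by omega)]
        rfl
      · unfold fTenC
        simp only
        rw [phi_T hn _ _ _ _ (by omega), if_neg (by omega),
          fV hn _ _ _ _ _ (by omega) (by omega) (by omega)]
        rfl
    refine ⟨hι', ?_⟩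
    have he : eTenC n l k 0 (V n 0 0 l (k + j + 1), tripleVec n a c d) =
        some (V n 0 0 l (k + j), tripleVec n a c d) := by
      unfold eTenC
      simp only
      rw [phi_V hn _ _ _ _ _ (by omega) (by omega) (by omega), eps_T hn _ _ _ _ (by omega),
          if_pos (by omega), eV hn _ _ _ _ _ (by omega) (by omega) (by omega)]
      rfl
    have := hH.1 _ (hm (k + j + 1) (by omega)) 0 (by omega) _ he
    rw [hι'] at this
    simp only [if_true] at this
    rw [phi_V hn _ _ _ _ _ (by omega) (by omega) (by omega), eps_T hn _ _ _ _ (by omega),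
      phi_T hn _ _ _ _ (by omega), eps_V hn _ _ _ _ _ (by omega) (by omega) (by omega),
      if_neg (by omega), if_neg (by omega), ihH] at this
    omega

end tens

/-- **Lemma 4.5, case 1** (type II highest elements).  If `l-k > y₀ ≥ x_1 - x̄_1` then, with
`z = min(y₀ + x̄_1 - x_1, l - k - y₀)`, the isomorphism maps
`(l-2y₀,0,---,0) ⊗ (x_1,x_2,---,x̄_1)` to
`(k,0,…,0) ⊗ (x_1+l-k-y₀-z, x_2, ---, x̄_1+y₀-z)` and the energy is `0`. -/
theorem lemma_4_5_case1
    (n l k : ℕ) (hn : 2 ≤ n) (hk : 1 ≤ k) (hkl : k ≤ l)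
    (ι : Tup n × Tup n → Tup n × Tup n) (hι : IsIsoC n l k ι)
    (H : Tup n × Tup n → ℤ) (hH : IsEnergyC n l k ι H)
    (y a c : ℕ) (hy : 1 ≤ y) (hac : a + c ≤ k)
    (hyl : 2 * (y : ℤ) - (a : ℤ) ≤ (l : ℤ) - (k : ℤ))
    (d : ℕ) (hd : d = k - a - c)
    (hcase1 : y < l - k) (hcase2 : (a : ℤ) - (d : ℤ) ≤ (y : ℤ))
    (z : ℕ) (hz : z = min (y + d - a) (l - k - y)) :
    ι (uvec n (l - 2 * y), tripleVec n a c d) =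
      (uvec n k, tripleVec n (a + (l - k - y - z)) c (d + y - z)) ∧
    H (uvec n (l - 2 * y), tripleVec n a c d) = 0 := by
  have had : a ≤ d + (l - k) := by omega
  obtain ⟨r1, r2⟩ := stage5 hn l k hkl ι hι H hH c a d (by omega) had (l - k - y) (by omega)
    (by omega)
  obtain ⟨-, s2⟩ := stage5 hn l k hkl ι hι H hH k 0 0 (by omega) (by omega) (l - k) le_rfl
    (by omega)
  rw [show k + (l - k) = l by omega, V_top, ← uvec_eq, ← u2vec_eq, hH.2] at s2
  have e1 : uvec n (l - 2 * y) = V n 0 0 l (k + (l - k - y)) := by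
    rw [uvec_eq]; unfold V; congr 1 <;> omega
  have e2 : V n a c (d + (l - k)) (l - k - y) =
      tripleVec n (a + (l - k - y - z)) c (d + y - z) := by
    unfold V; congr 1 <;> omega
  rw [e1, uvec_eq, ← e2]
  exact ⟨r1, by rw [r2, ← s2]⟩
end KTT
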